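/- arXiv:1809.08139 — 4 statements merged into one kernel-verified Lean document; each statement's English description precedes it below -/
import Mathlib

section
/- Let d ≥ 1, let D be a symmetric positive definite real d×d matrix, let ŝ, s̃ ∈ ℝ^d, let r, x ∈ ℝ, let q ∈ ℝ^{1+d} with q1 > 0, and let M be a symmetric (1+d)×(1+d) real matrix with M11 < 0. For α ∈ ℝ^d and c > 0 define H₀(α, c) = (r·x − αᵀŝ − c)·q1 + Σ_{i=1}^d s̃_i·q_{1+i} + (1/2)[ αᵀDα·M11 + 2·Σ_{i=1}^d (Dα)_i·M_{1,1+i} + Σ_{k,i=1}^d D_{ki}·M_{1+k,1+i} ] + ln c. Then, with μ = (M_{1,2}, …, M_{1,1+d})ᵀ and τ = q1·ŝ − Dμ, sup_{α ∈ ℝ^d, c > 0} H₀(α, c) = r·x·q1 + Σ_{i=1}^d s̃_i·q_{1+i} + (1/2)·Σ_{k,i=1}^d D_{ki}·M_{1+k,1+i} − 1 − ln q1 + τᵀD⁻¹τ/(2|M11|), and the supremum is attained uniquely at α⁰ = (1/M11)·D⁻¹τ and c⁰ = 1/q1. -/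
open Matrix

/-- Completing the square: with `D v = τ` for a symmetric `D` and `m ≠ 0`, the concave quadratic
`α ↦ (m/2) αᵀDα - αᵀτ` is centred at `m⁻¹ v`. -/
theorem half_mul_quadratic_sub_dotProduct {n : Type*} [Fintype n] {D : Matrix n n ℝ}
    (hD : D.IsSymm) {m : ℝ} (hm : m ≠ 0) {v τ : n → ℝ} (hv : D *ᵥ v = τ) (α : n → ℝ) :
    m / 2 * (α ⬝ᵥ D *ᵥ α) - α ⬝ᵥ τ =
      m / 2 * ((α - (1 / m) • v) ⬝ᵥ D *ᵥ (α - (1 / m) • v)) - τ ⬝ᵥ v / (2 * m) := by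
  have hcross : v ⬝ᵥ D *ᵥ α = α ⬝ᵥ τ := by
    rw [dotProduct_mulVec, ← mulVec_transpose, hD.eq, hv, dotProduct_comm]
  simp only [mulVec_sub, mulVec_smul, sub_dotProduct, dotProduct_sub, smul_dotProduct,
    dotProduct_smul, smul_eq_mul, hv, hcross, dotProduct_comm v τ]
  field_simp
  ring

/-- Full maximization of the pre-supremum Hamiltonian `H₀(α, c)` over
`(α, c) ∈ ℝ^d × (0, ∞)`: the supremum equals
`r·x·q1 + Σ s̃_i q_{1+i} + (1/2)Σ D_{ki} M_{1+k,1+i} − 1 − ln q1 + τᵀD⁻¹τ/(2|M11|)`,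
attained uniquely at `α⁰ = (1/M11)·D⁻¹τ` and `c⁰ = 1/q1`. -/
theorem stmt_4 (d : ℕ) (hd : 1 ≤ d)
    (D : Matrix (Fin d) (Fin d) ℝ) (hDsymm : D.IsSymm) (hD : D.PosDef)
    (shat stil : Fin d → ℝ) (r x : ℝ)
    (q : Fin (d + 1) → ℝ) (hq1 : 0 < q 0)
    (M : Matrix (Fin (d + 1)) (Fin (d + 1)) ℝ) (hMsymm : M.IsSymm) (hM11 : M 0 0 < 0)
    (H0 : (Fin d → ℝ) → ℝ → ℝ)
    (hH0 : ∀ (α : Fin d → ℝ) (c : ℝ),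
      H0 α c = (r * x - α ⬝ᵥ shat - c) * q 0 + (∑ i : Fin d, stil i * q i.succ)
        + (1 / 2) * ((α ⬝ᵥ D.mulVec α) * M 0 0
            + 2 * ∑ i : Fin d, D.mulVec α i * M 0 i.succ
            + ∑ k : Fin d, ∑ i : Fin d, D k i * M k.succ i.succ)
        + Real.log c)
    (μ : Fin d → ℝ) (hμ : μ = fun i => M 0 i.succ)
    (τ : Fin d → ℝ) (hτ : τ = q 0 • shat - D.mulVec μ)
    (V : ℝ)
    (hV : V = r * x * q 0 + (∑ i : Fin d, stil i * q i.succ)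
        + (1 / 2) * ∑ k : Fin d, ∑ i : Fin d, D k i * M k.succ i.succ
        - 1 - Real.log (q 0) + τ ⬝ᵥ (D⁻¹).mulVec τ / (2 * |M 0 0|))
    (α0 : Fin d → ℝ) (hα0 : α0 = (1 / M 0 0) • (D⁻¹).mulVec τ)
    (c0 : ℝ) (hc0 : c0 = 1 / q 0) :
    (∀ (α : Fin d → ℝ) (c : ℝ), 0 < c → H0 α c ≤ V) ∧
    H0 α0 c0 = V ∧
    (∀ (α : Fin d → ℝ) (c : ℝ), 0 < c → H0 α c = V → α = α0 ∧ c = c0) := by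
  have hDv : D *ᵥ (D⁻¹ *ᵥ τ) = τ := by
    rw [mulVec_mulVec, mul_nonsing_inv D hD.det_pos.ne'.isUnit, one_mulVec]
  have hlin (α : Fin d → ℝ) :
      α ⬝ᵥ τ = q 0 * (α ⬝ᵥ shat) - ∑ i : Fin d, (D *ᵥ α) i * M 0 i.succ := by
    have hμα : ∑ i : Fin d, (D *ᵥ α) i * M 0 i.succ = α ⬝ᵥ D *ᵥ μ := by
      rw [dotProduct_mulVec, ← mulVec_transpose, hDsymm.eq, hμ]
      rfl
    rw [hμα, hτ, dotProduct_sub, dotProduct_smul, smul_eq_mul]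
  have key (α : Fin d → ℝ) (c : ℝ) (hc : 0 < c) :
      H0 α c = V + M 0 0 / 2 * ((α - α0) ⬝ᵥ D *ᵥ (α - α0))
        + (Real.log (c * q 0) - (c * q 0 - 1)) := by
    have hsq := half_mul_quadratic_sub_dotProduct hDsymm hM11.ne hDv α
    rw [← hα0, hlin] at hsq
    rw [hH0, hV, Real.log_mul hc.ne' hq1.ne', abs_of_neg hM11, mul_neg, div_neg]
    linear_combination hsq
  have hquad (α : Fin d → ℝ) : 0 ≤ (α - α0) ⬝ᵥ D *ᵥ (α - α0) := by
    simpa using hD.posSemidef.dotProduct_mulVec_nonneg (α - α0)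
  have hlog (c : ℝ) (hc : 0 < c) : Real.log (c * q 0) ≤ c * q 0 - 1 :=
    Real.log_le_sub_one_of_pos (mul_pos hc hq1)
  refine ⟨fun α c hc => ?_, ?_, fun α c hc h => ?_⟩
  · rw [key α c hc]
    nlinarith [hquad α, hlog c hc]
  · rw [key α0 c0 (hc0 ▸ one_div_pos.2 hq1), hc0, one_div_mul_cancel hq1.ne']
    simp
  · rw [key α c hc] at h
    constructor
    · by_contra hne
      have hpos : 0 < (α - α0) ⬝ᵥ D *ᵥ (α - α0) := by
        simpa using hD.dotProduct_mulVec_pos (sub_ne_zero.2 hne)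
      nlinarith [hlog c hc]
    · by_contra hne
      have hcq : c * q 0 ≠ 1 := fun h1 => hne (hc0 ▸ eq_one_div_of_mul_eq_one_left h1)
      nlinarith [hquad α, Real.log_lt_sub_one_of_pos (mul_pos hc hq1) hcq]
end

section
/- Let d ≥ 1, r ≥ 0, T > 0, let A be a real d×d matrix, set A₁ = r·I_d − A, and let D be a symmetric positive definite real d×d matrix. Set ρ(t) = T − t + 1, let Q: [0, T] → (symmetric d×d matrices) satisfy Q′(t) + (1/2)·ρ(t)·A₁ᵀD⁻¹A₁ + AᵀQ(t) + Q(t)A = 0, Q(T) = 0, let f(t) = ∫_t^T ( r·ρ(v) − 1 − ln ρ(v) + tr(D·Q(v)) ) dv, and let z(x, s, t) = ρ(t)·ln x + sᵀQ(t)s + f(t). Fix x > 0, s ∈ ℝ^d, t ∈ [0, T], and for α ∈ ℝ^d, c > 0 define H₀(α, c) = (r·x − αᵀ(A₁s) − c)·∂_x z + Σ_i (As)_i·∂_{s_i} z + (1/2)[ αᵀDα·∂_{xx} z + 2·Σ_i (Dα)_i·∂²_{x s_i} z + Σ_{k,i} D_{ki}·∂²_{s_k s_i} z ] + ln c. Then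 H₀ attains its supremum over ℝ^d × (0, ∞) uniquely at α⁰ = −x·D⁻¹A₁s and c⁰ = x/ρ(t). -/
open Matrix

/-- Completing the square for the quadratic form of a symmetric matrix. -/
theorem Matrix.IsSymm.dotProduct_mulVec_add_smul {n : Type*} [Fintype n] {D : Matrix n n ℝ}
    (hD : D.IsSymm) (v w : n → ℝ) (x : ℝ) :
    (v + x • w) ⬝ᵥ D *ᵥ (v + x • w)
      = v ⬝ᵥ D *ᵥ v + 2 * x * (v ⬝ᵥ D *ᵥ w) + x ^ 2 * (w ⬝ᵥ D *ᵥ w) := by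
  have h : w ⬝ᵥ D *ᵥ v = v ⬝ᵥ D *ᵥ w := by
    rw [dotProduct_mulVec, ← mulVec_transpose, hD.eq, dotProduct_comm]
  simp only [mulVec_add, mulVec_smul, dotProduct_add, add_dotProduct, smul_dotProduct,
    dotProduct_smul, smul_eq_mul, h]
  ring

theorem deriv_const_mul_log_add_const (a b y : ℝ) :
    deriv (fun u => a * Real.log u + b) y = a * y⁻¹ := by
  simp

theorem deriv_const_mul_inv (a y : ℝ) : deriv (fun u : ℝ => a * u⁻¹) y = -(a / y ^ 2) := by
  simp [div_eq_mul_inv]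

theorem log_sub_mul_le {k c : ℝ} (hk : 0 < k) (hc : 0 < c) :
    Real.log c - k * c ≤ -Real.log k - 1 := by
  have h := Real.log_le_sub_one_of_pos (mul_pos hk hc)
  rw [Real.log_mul hk.ne' hc.ne'] at h
  linarith

theorem eq_inv_of_log_sub_mul_eq {k c : ℝ} (hk : 0 < k) (hc : 0 < c)
    (h : Real.log c - k * c = -Real.log k - 1) : c = k⁻¹ := by
  by_contra hne
  have h1 : k * c ≠ 1 := fun h' => hne (eq_inv_of_mul_eq_one_right h')
  have h2 := Real.log_lt_sub_one_of_pos (mul_pos hk hc) h1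
  rw [Real.log_mul hk.ne' hc.ne'] at h2
  linarith

/-- The optimal feedback strategies `α⁰ = −x·D⁻¹A₁s`, `c⁰ = x/ρ(t)` are the unique
maximizers over `ℝ^d × (0, ∞)` of the Hamiltonian `H₀` evaluated at the derivatives
of the value function `z(x, s, t) = ρ(t)·ln x + sᵀQ(t)s + f(t)`. -/
theorem stmt_11 (d : ℕ) (hd : 1 ≤ d) (r : ℝ) (hr : 0 ≤ r) (T : ℝ) (hT : 0 < T)
    (A : Matrix (Fin d) (Fin d) ℝ)
    (A₁ : Matrix (Fin d) (Fin d) ℝ) (hA₁ : A₁ = r • (1 : Matrix (Fin d) (Fin d) ℝ) - A)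
    (D : Matrix (Fin d) (Fin d) ℝ) (hDsymm : D.IsSymm) (hD : D.PosDef)
    (ρ : ℝ → ℝ) (hρ : ∀ t, ρ t = T - t + 1)
    (Q Q' : ℝ → Matrix (Fin d) (Fin d) ℝ)
    (hQsymm : ∀ t, (Q t).IsSymm)
    (hQdiff : ∀ t ∈ Set.Icc (0 : ℝ) T, ∀ i j, HasDerivAt (fun u => Q u i j) (Q' t i j) t)
    (hQode : ∀ t ∈ Set.Icc (0 : ℝ) T,
      Q' t + (1 / 2 * ρ t) • (A₁ᵀ * D⁻¹ * A₁) + Aᵀ * Q t + Q t * A = 0)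
    (hQT : Q T = 0)
    (f : ℝ → ℝ)
    (hf : ∀ t, f t = ∫ v in t..T, (r * ρ v - 1 - Real.log (ρ v) + (D * Q v).trace))
    (z : ℝ → (Fin d → ℝ) → ℝ → ℝ)
    (hz : ∀ x s t, z x s t = ρ t * Real.log x + s ⬝ᵥ (Q t).mulVec s + f t)
    (x : ℝ) (hx : 0 < x) (s : Fin d → ℝ) (t : ℝ) (ht : t ∈ Set.Icc (0 : ℝ) T)
    (zx : ℝ) (hzx : zx = deriv (fun y => z y s t) x)
    (zxx : ℝ) (hzxx : zxx = deriv (fun y => deriv (fun y' => z y' s t) y) x)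
    (zs : Fin d → ℝ)
    (hzs : ∀ i, zs i = deriv (fun u => z x (Function.update s i u) t) (s i))
    (zxs : Fin d → ℝ)
    (hzxs : ∀ i,
      zxs i = deriv (fun u => deriv (fun y => z y (Function.update s i u) t) x) (s i))
    (zss : Fin d → Fin d → ℝ)
    (hzss : ∀ i k, zss i k =
      deriv (fun u =>
        deriv (fun w => z x (Function.update (Function.update s i u) k w) t)
          (Function.update s i u k)) (s i))
    (H0 : (Fin d → ℝ) → ℝ → ℝ)
    (hH0 : ∀ (α : Fin d → ℝ) (c : ℝ),
      H0 α c = (r * x - α ⬝ᵥ (A₁.mulVec s) - c) * zx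
        + (∑ i : Fin d, A.mulVec s i * zs i)
        + (1 / 2) * ((α ⬝ᵥ D.mulVec α) * zxx + 2 * ∑ i : Fin d, D.mulVec α i * zxs i
            + ∑ k : Fin d, ∑ i : Fin d, D k i * zss k i)
        + Real.log c)
    (α0 : Fin d → ℝ) (hα0 : α0 = -x • (D⁻¹).mulVec (A₁.mulVec s))
    (c0 : ℝ) (hc0 : c0 = x / ρ t) :
    (∀ (α : Fin d → ℝ) (c : ℝ), 0 < c → H0 α c ≤ H0 α0 c0) ∧
    (∀ (α : Fin d → ℝ) (c : ℝ), 0 < c → H0 α c = H0 α0 c0 → α = α0 ∧ c = c0) := by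
  have hρt : 0 < ρ t := by rw [hρ]; linarith [ht.2]
  have hzderiv : ∀ (s' : Fin d → ℝ) (y : ℝ), deriv (fun y => z y s' t) y = ρ t * y⁻¹ := by
    intro s' y
    simp only [hz, add_assoc]
    exact deriv_const_mul_log_add_const _ _ y
  simp only [hzderiv, deriv_const] at hzx hzxx hzxs
  rw [deriv_const_mul_inv] at hzxx
  have hk : 0 < ρ t / x := by positivity
  obtain ⟨w, hw⟩ : ∃ w, w = D⁻¹ *ᵥ (A₁ *ᵥ s) := ⟨_, rfl⟩
  have hDw : D *ᵥ w = A₁ *ᵥ s := by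
    rw [hw, mulVec_mulVec, mul_nonsing_inv _ hD.det_pos.ne'.isUnit, one_mulVec]
  have hα0' : α0 + x • w = 0 := by rw [hα0, hw]; simp
  have hc0' : c0 = (ρ t / x)⁻¹ := by rw [hc0, inv_div]
  obtain ⟨C, hC⟩ : ∃ C, ∀ α c, H0 α c
      = C - ρ t / (2 * x ^ 2) * ((α + x • w) ⬝ᵥ D *ᵥ (α + x • w))
        + (Real.log c - ρ t / x * c) := by
    refine ⟨r * ρ t + (∑ i, (A *ᵥ s) i * zs i) + 1 / 2 * (∑ k, ∑ i, D k i * zss k i)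
      + ρ t / 2 * (w ⬝ᵥ D *ᵥ w), fun α c => ?_⟩
    rw [hH0, hDsymm.dotProduct_mulVec_add_smul, ← hDw, hzx, hzxx]
    simp only [hzxs, mul_zero, Finset.sum_const_zero]
    field_simp
    ring
  have hmax : H0 α0 c0 = C + (-Real.log (ρ t / x) - 1) := by
    rw [hC, hα0', hc0', Real.log_inv, mul_inv_cancel₀ hk.ne']
    simp
  have hcoef : 0 < ρ t / (2 * x ^ 2) := by positivity
  have hquad : ∀ v : Fin d → ℝ, 0 ≤ v ⬝ᵥ D *ᵥ v := fun v => by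
    simpa using hD.posSemidef.dotProduct_mulVec_nonneg v
  refine ⟨fun α c hc => ?_, fun α c hc h => ?_⟩
  · rw [hmax, hC]
    linarith [log_sub_mul_le hk hc, mul_nonneg hcoef.le (hquad (α + x • w))]
  · rw [hmax, hC] at h
    have hlog := log_sub_mul_le hk hc
    have hq := mul_nonneg hcoef.le (hquad (α + x • w))
    refine ⟨?_, hc0' ▸ eq_inv_of_log_sub_mul_eq hk hc (by linarith)⟩
    have hzero : α + x • w = 0 := by
      by_contra hne
      have hpos : 0 < (α + x • w) ⬝ᵥ D *ᵥ (α + x • w) := by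
        simpa using hD.dotProduct_mulVec_pos hne
      linarith [mul_pos hcoef hpos]
    exact add_right_cancel (hzero.trans hα0'.symm)
end

section
/- Let κ > 0, r ≥ 0, σ ≠ 0, T > 0, and set κ₁ = κ + r and ρ(t) = T − t + 1. Define g(t) = (κ₁²/(2σ²))·∫_t^T ρ(v)·e^{2κ(t−v)} dv and f(t) = ∫_t^T ( r·ρ(v) − 1 − ln ρ(v) + σ²·g(v) ) dv, and set z(x, s, t) = ρ(t)·ln x + g(t)·s² + f(t) for x > 0, s ∈ ℝ, t ∈ [0, T]. Then z satisfies the one-dimensional Hamilton–Jacobi–Bellman equation: for all x > 0, s ∈ ℝ, t ∈ [0, T], ∂_t z + r·x·∂_x z + (κ₁·s·∂_x z − σ²·∂²_{xs} z)² / (2σ²·|∂_{xx} z|) − 1 − ln(∂_x z) − κ·s·∂_s z + (σ²/2)·∂²_{ss} z = 0, together with the terminal condition z(x, s, T) = ln x. -/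
/-- Differentiating under and at the lower limit of an integral against an exponential kernel. -/
theorem hasDerivAt_integral_mul_exp_kernel {h : ℝ → ℝ} (hh : Continuous h) (a T t : ℝ) :
    HasDerivAt (fun u => ∫ v in u..T, h v * Real.exp (a * (u - v)))
      (a * (∫ v in t..T, h v * Real.exp (a * (t - v))) - h t) t := by
  have factor : ∀ u, ∫ v in u..T, h v * Real.exp (a * (u - v)) =
      Real.exp (a * u) * ∫ v in u..T, h v * Real.exp (-(a * v)) := by
    intro u
    rw [← intervalIntegral.integral_const_mul]
    congr 1
    ext v
    rw [show a * (u - v) = a * u + -(a * v) by ring, Real.exp_add]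
    ring
  have hcont : Continuous fun v => h v * Real.exp (-(a * v)) := by fun_prop
  have hint := intervalIntegral.integral_hasDerivAt_left (hcont.intervalIntegrable t T)
    (hcont.stronglyMeasurableAtFilter _ _) hcont.continuousAt
  have hexp : HasDerivAt (fun u => Real.exp (a * u)) (Real.exp (a * t) * a) t := by
    simpa using ((hasDerivAt_id t).const_mul a).exp
  simp only [factor]
  refine (hexp.mul hint).congr_deriv ?_
  have hcancel : Real.exp (a * t) * Real.exp (-(a * t)) = 1 := by
    rw [← Real.exp_add, add_neg_cancel, Real.exp_zero]
  linear_combination (-h t) * hcancel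

/-- The derivative of an integral with respect to its lower limit, for an integrand that is
continuous on an open ray containing the interval of integration. -/
theorem hasDerivAt_integral_left_of_continuousOn_Iio {F : ℝ → ℝ} {b T t : ℝ}
    (hF : ContinuousOn F (Set.Iio b)) (htT : t ≤ T) (hTb : T < b) :
    HasDerivAt (fun u => ∫ v in u..T, F v) (-F t) t := by
  have htb : t < b := htT.trans_lt hTb
  refine intervalIntegral.integral_hasDerivAt_left ?_
    (hF.stronglyMeasurableAtFilter isOpen_Iio t htb) (hF.continuousAt (Iio_mem_nhds htb))
  refine (hF.mono fun v hv => ?_).intervalIntegrable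
  rw [Set.uIcc_of_le htT] at hv
  exact hv.2.trans_lt hTb

/-- Example 1 of the paper (one-dimensional case):
`z(x, s, t) = ρ(t)·ln x + g(t)·s² + f(t)` solves the one-dimensional HJB equation
for the Ornstein–Uhlenbeck spread market `dS_t = −κS_t dt + σ dW_t`, together with
the terminal condition `z(x, s, T) = ln x`. -/
theorem stmt_12 (κ r σ T : ℝ) (hκ : 0 < κ) (hr : 0 ≤ r) (hσ : σ ≠ 0) (hT : 0 < T)
    (κ₁ : ℝ) (hκ₁ : κ₁ = κ + r)
    (ρ : ℝ → ℝ) (hρ : ∀ t, ρ t = T - t + 1)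
    (g : ℝ → ℝ)
    (hg : ∀ t, g t = κ₁ ^ 2 / (2 * σ ^ 2) * ∫ v in t..T, ρ v * Real.exp (2 * κ * (t - v)))
    (f : ℝ → ℝ)
    (hf : ∀ t, f t = ∫ v in t..T, (r * ρ v - 1 - Real.log (ρ v) + σ ^ 2 * g v))
    (z : ℝ → ℝ → ℝ → ℝ)
    (hz : ∀ x s t, z x s t = ρ t * Real.log x + g t * s ^ 2 + f t) :
    ∀ x : ℝ, 0 < x → ∀ s : ℝ, ∀ t ∈ Set.Icc (0 : ℝ) T,
      (let zt := deriv (fun u => z x s u) t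
       let zx := deriv (fun y => z y s t) x
       let zxx := deriv (fun y => deriv (fun y' => z y' s t) y) x
       let zs := deriv (fun u => z x u t) s
       let zss := deriv (fun u => deriv (fun w => z x w t) u) s
       let zxs := deriv (fun u => deriv (fun y => z y u t) x) s
       zt + r * x * zx + (κ₁ * s * zx - σ ^ 2 * zxs) ^ 2 / (2 * σ ^ 2 * |zxx|)
         - 1 - Real.log zx - κ * s * zs + σ ^ 2 / 2 * zss = 0) ∧
      z x s T = Real.log x := by
  intro x hx s t ht
  obtain rfl : ρ = fun t => T - t + 1 := funext hρ
  obtain rfl : z = fun x s t => (T - t + 1) * Real.log x + g t * s ^ 2 + f t := by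
    ext x s t
    exact hz x s t
  have hρpos : 0 < T - t + 1 := by linarith [ht.2]
  have hg' : ∀ u, HasDerivAt g (2 * κ * g u - κ₁ ^ 2 / (2 * σ ^ 2) * (T - u + 1)) u := by
    intro u
    have h := (hasDerivAt_integral_mul_exp_kernel (h := fun t => T - t + 1) (by fun_prop)
      (2 * κ) T u).const_mul (κ₁ ^ 2 / (2 * σ ^ 2))
    rw [← funext hg] at h
    refine h.congr_deriv ?_
    rw [hg u]
    ring
  have hgcont : Continuous g := continuous_iff_continuousAt.2 fun u => (hg' u).continuousAt
  have hf' : HasDerivAt f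
      (-(r * (T - t + 1) - 1 - Real.log (T - t + 1) + σ ^ 2 * g t)) t := by
    rw [funext hf]
    refine hasDerivAt_integral_left_of_continuousOn_Iio (b := T + 1)
      (F := fun v => r * (T - v + 1) - 1 - Real.log (T - v + 1) + σ ^ 2 * g v)
      ?_ ht.2 (by linarith)
    have hlog : ContinuousOn (fun v => Real.log (T - v + 1)) (Set.Iio (T + 1)) :=
      ContinuousOn.log (by fun_prop) fun v hv => by
        have : v < T + 1 := hv
        linarith
    fun_prop
  have hzt : HasDerivAt (fun u => (T - u + 1) * Real.log x + g u * s ^ 2 + f u)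
      (-Real.log x + (2 * κ * g t - κ₁ ^ 2 / (2 * σ ^ 2) * (T - t + 1)) * s ^ 2 +
        -(r * (T - t + 1) - 1 - Real.log (T - t + 1) + σ ^ 2 * g t)) t := by
    have hlin : HasDerivAt (fun u : ℝ => T - u + 1) (-1) t := by
      simpa using ((hasDerivAt_id t).const_sub T).add_const 1
    exact (((hlin.mul_const (Real.log x)).add ((hg' t).mul_const (s ^ 2))).add hf').congr_deriv
      (by ring)
  have hzx : ∀ y u : ℝ, deriv (fun y => (T - t + 1) * Real.log y + g t * u ^ 2 + f t) y =
      (T - t + 1) * y⁻¹ := by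
    intro y u
    simp
  have hzxx : deriv (fun y : ℝ => (T - t + 1) * y⁻¹) x = -((T - t + 1) / x ^ 2) := by
    simp [div_eq_mul_inv]
  have hzs : ∀ u : ℝ, deriv (fun u => (T - t + 1) * Real.log x + g t * u ^ 2 + f t) u =
      2 * g t * u := by
    intro u
    simp
    ring
  have hzss : deriv (fun u : ℝ => 2 * g t * u) s = 2 * g t := by
    simp
  refine ⟨?_, ?_⟩
  · simp only [hzt.deriv, hzx, hzxx, hzs, hzss, deriv_const]
    rw [abs_neg, abs_of_pos (by positivity), Real.log_mul hρpos.ne' (inv_ne_zero hx.ne'),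
      Real.log_inv]
    field_simp
    ring
  · simp [hg T, hf T]
end

section
/- Let κ > 0, r ≥ 0, σ ≠ 0, T > 0, set κ₁ = κ + r and ρ(t) = T − t + 1, and let g and f be as follows: g(t) = (κ₁²/(2σ²))·∫_t^T ρ(v)·e^{2κ(t−v)} dv and f(t) = ∫_t^T ( r·ρ(v) − 1 − ln ρ(v) + σ²·g(v) ) dv, with z(x, s, t) = ρ(t)·ln x + g(t)·s² + f(t). Fix x > 0, s ∈ ℝ, t ∈ [0, T], and for α ∈ ℝ, c > 0 define H₀(α, c) = (r·x − α·κ₁·s − c)·∂_x z − κ·s·∂_s z + (1/2)[ α²σ²·∂_{xx} z + 2ασ²·∂²_{xs} z + σ²·∂²_{ss} z ] + ln c. Then H₀ attains its supremum over ℝ × (0, ∞) uniquely at α⁰ = −κ₁·s·x/σ² and c⁰ = x/ρ(t). -/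
theorem deriv_mul_log_add_add (a b c x : ℝ) :
    deriv (fun y => a * Real.log y + b + c) x = a / x := by
  simp [div_eq_mul_inv]

/-- Example 1 of the paper: in the one-dimensional Ornstein–Uhlenbeck spread market,
the Hamiltonian `H₀(α, c)` evaluated at the derivatives of the value function
`z(x, s, t) = ρ(t)·ln x + g(t)·s² + f(t)` attains its supremum over `ℝ × (0, ∞)`
uniquely at `α⁰ = −κ₁·s·x/σ²` and `c⁰ = x/ρ(t)`. -/
theorem stmt_14 (κ r σ T : ℝ) (hκ : 0 < κ) (hr : 0 ≤ r) (hσ : σ ≠ 0) (hT : 0 < T)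
    (κ₁ : ℝ) (hκ₁ : κ₁ = κ + r)
    (ρ : ℝ → ℝ) (hρ : ∀ t, ρ t = T - t + 1)
    (g : ℝ → ℝ)
    (hg : ∀ t, g t = κ₁ ^ 2 / (2 * σ ^ 2) * ∫ v in t..T, ρ v * Real.exp (2 * κ * (t - v)))
    (f : ℝ → ℝ)
    (hf : ∀ t, f t = ∫ v in t..T, (r * ρ v - 1 - Real.log (ρ v) + σ ^ 2 * g v))
    (z : ℝ → ℝ → ℝ → ℝ)
    (hz : ∀ x s t, z x s t = ρ t * Real.log x + g t * s ^ 2 + f t)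
    (x : ℝ) (hx : 0 < x) (s : ℝ) (t : ℝ) (ht : t ∈ Set.Icc (0 : ℝ) T)
    (zx : ℝ) (hzx : zx = deriv (fun y => z y s t) x)
    (zxx : ℝ) (hzxx : zxx = deriv (fun y => deriv (fun y' => z y' s t) y) x)
    (zs : ℝ) (hzs : zs = deriv (fun u => z x u t) s)
    (zss : ℝ) (hzss : zss = deriv (fun u => deriv (fun w => z x w t) u) s)
    (zxs : ℝ) (hzxs : zxs = deriv (fun u => deriv (fun y => z y u t) x) s)
    (H0 : ℝ → ℝ → ℝ)
    (hH0 : ∀ (α : ℝ) (c : ℝ),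
      H0 α c = (r * x - α * κ₁ * s - c) * zx - κ * s * zs
        + (1 / 2) * (α ^ 2 * σ ^ 2 * zxx + 2 * α * σ ^ 2 * zxs + σ ^ 2 * zss)
        + Real.log c)
    (α0 : ℝ) (hα0 : α0 = -(κ₁ * s * x) / σ ^ 2)
    (c0 : ℝ) (hc0 : c0 = x / ρ t) :
    (∀ (α : ℝ) (c : ℝ), 0 < c → H0 α c ≤ H0 α0 c0) ∧
    (∀ (α : ℝ) (c : ℝ), 0 < c → H0 α c = H0 α0 c0 → α = α0 ∧ c = c0) := by
  have hρt : 0 < ρ t := by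
    rw [hρ]
    linarith [ht.2]
  have hzx_eq (u y : ℝ) : deriv (fun y' => z y' u t) y = ρ t / y := by
    simp_rw [hz]
    exact deriv_mul_log_add_add _ _ _ _
  rw [hzx_eq] at hzx
  simp_rw [hzx_eq] at hzxx hzxs
  rw [deriv_const_div_id] at hzxx
  rw [deriv_const] at hzxs
  have hc0_pos : 0 < c0 := hc0 ▸ div_pos hx hρt
  have gap (α c : ℝ) (hc : 0 < c) : H0 α0 c0 - H0 α c =
      ρ t * σ ^ 2 / (2 * x ^ 2) * (α - α0) ^ 2
        + (c / c0 - 1 - Real.log (c / c0)) := by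
    rw [Real.log_div hc.ne' hc0_pos.ne', hH0, hH0, hzx, hzxx, hzxs]
    generalize Real.log c0 = l
    rw [hα0, hc0]
    field_simp
    ring
  have hcoef : 0 < ρ t * σ ^ 2 / (2 * x ^ 2) := by positivity
  refine ⟨fun α c hc => ?_, fun α c hc heq => ?_⟩
  · have hlog := Real.log_le_sub_one_of_pos (div_pos hc hc0_pos)
    have hsq := mul_nonneg hcoef.le (sq_nonneg (α - α0))
    linarith [gap α c hc]
  · have hlog := Real.log_le_sub_one_of_pos (div_pos hc hc0_pos)
    have hsq := mul_nonneg hcoef.le (sq_nonneg (α - α0))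
    have hgap := gap α c hc
    constructor
    · have hzero : ρ t * σ ^ 2 / (2 * x ^ 2) * (α - α0) ^ 2 = 0 := by linarith
      exact sub_eq_zero.mp (pow_eq_zero_iff two_ne_zero |>.mp
        ((mul_eq_zero.mp hzero).resolve_left hcoef.ne'))
    · by_contra hne
      have hlt := Real.log_lt_sub_one_of_pos (div_pos hc hc0_pos)
        fun h => hne ((div_eq_one_iff_eq hc0_pos.ne').mp h)
      linarith
end
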